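/- arXiv:2107.10798 — 2 statements merged into one kernel-verified Lean document; each statement's English description precedes it below -/
import Mathlib

section
/- Let f : ℝ → ℝ be a smooth, positive, rapidly decaying function with moments n_f > 0, u_f, θ_f > 0. Then ∫_ℝ ν·∂_v((v−u_f)f + θ_f·∂_v f)·log f dv = −ν·∫_ℝ ((v−u_f)·√f + 2θ_f·∂_v√f)²/θ_f dv ≤ 0, after writing the integrand in the form −(1/θ_f)·((v−u_f)f + θ_f ∂_v f)²/f. -/
open MeasureTheory Real

lemma lb_nonpos_of_deriv (φ φ' : ℝ → ℝ) (hd : ∀ x, HasDerivAt φ (φ' x) x) (h0 : φ 0 = 0)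
    (hn : ∀ x, 0 ≤ x → φ' x ≤ 0) (x : ℝ) (hx : 0 ≤ x) : φ x ≤ 0 := by
  have : AntitoneOn φ (Set.Ici 0) := by
    apply antitoneOn_of_deriv_nonpos (convex_Ici 0)
    · exact fun y _ => (hd y).continuousAt.continuousWithinAt
    · exact fun y _ => (hd y).differentiableAt.differentiableWithinAt
    · intro y hy
      rw [(hd y).deriv]
      rw [interior_Ici] at hy
      exact hn y (le_of_lt hy)
  have := this (Set.mem_Ici.2 le_rfl) (Set.mem_Ici.2 hx) hx
  linarith

lemma lb_shift {g g1 : ℝ → ℝ} (hd : ∀ x, HasDerivAt g (g1 x) x) (v x : ℝ) :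
    HasDerivAt (fun t => g (v + t)) (g1 (v + x)) x := by
  exact (hd (v + x)).comp_const_add v x

lemma lb_shift_neg {g g1 : ℝ → ℝ} (hd : ∀ x, HasDerivAt g (g1 x) x) (v x : ℝ) :
    HasDerivAt (fun t => g (v - t)) (-g1 (v - x)) x := by
  exact (hd (v - x)).comp_const_sub v x

lemma lb_lip {g g1 : ℝ → ℝ} (hd : ∀ x, HasDerivAt g (g1 x) x) {M : ℝ}
    (hM : ∀ x, |g1 x| ≤ M) (x y : ℝ) : |g y - g x| ≤ M * |y - x| := by
  have := Convex.norm_image_sub_le_of_norm_hasDerivWithin_le (f := g) (f' := g1) (s := Set.univ)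
    (C := M) (x := x) (y := y) (fun z _ => (hd z).hasDerivWithinAt) (fun z _ => hM z) convex_univ
    trivial trivial
  simpa using this

lemma lb_taylor {g g1 g2 : ℝ → ℝ} (h1 : ∀ x, HasDerivAt g (g1 x) x)
    (h2 : ∀ x, HasDerivAt g1 (g2 x) x) {M : ℝ} (hM : ∀ x, |g2 x| ≤ M) (v h : ℝ) :
    g (v + h) ≤ g v + g1 v * h + M * h ^ 2 / 2 := by
  rcases le_total 0 h with hh | hh
  · have := lb_nonpos_of_deriv (fun t => g (v + t) - g v - g1 v * t - M * t ^ 2 / 2)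
      (fun t => g1 (v + t) - g1 v - M * t) ?_ (by simp) ?_ h hh
    · linarith
    · intro x
      have := (((lb_shift h1 v x).sub_const (g v)).sub ((hasDerivAt_id x).const_mul (g1 v))).sub
        ((((hasDerivAt_id x).pow 2).const_mul M).div_const 2)
      refine this.congr_deriv ?_
      simp; ring
    · intro x hx
      have := lb_lip h2 hM v (v + x)
      rw [add_sub_cancel_left, abs_of_nonneg hx] at this
      linarith [le_abs_self (g1 (v + x) - g1 v)]
  · have := lb_nonpos_of_deriv (fun t => g (v - t) - g v + g1 v * t - M * t ^ 2 / 2)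
      (fun t => -g1 (v - t) + g1 v - M * t) ?_ (by simp) ?_ (-h) (by linarith)
    · simp only [sub_neg_eq_add] at this; linarith [neg_sq h]
    · intro x
      have := (((lb_shift_neg h1 v x).sub_const (g v)).add
        ((hasDerivAt_id x).const_mul (g1 v))).sub
        ((((hasDerivAt_id x).pow 2).const_mul M).div_const 2)
      refine this.congr_deriv ?_
      simp; ring
    · intro x hx
      have := lb_lip h2 hM v (v - x)
      rw [show v - x - v = -x by ring, abs_neg, abs_of_nonneg hx] at this
      linarith [neg_abs_le (g1 (v - x) - g1 v)]

lemma lb_sq_bound {g g1 g2 : ℝ → ℝ} (h1 : ∀ x, HasDerivAt g (g1 x) x)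
    (h2 : ∀ x, HasDerivAt g1 (g2 x) x) {M : ℝ} (hM0 : 0 < M) (hM : ∀ x, |g2 x| ≤ M)
    (hg : ∀ x, 0 ≤ g x) (v : ℝ) : g1 v ^ 2 ≤ 2 * M * g v := by
  have h := (hg _).trans (lb_taylor h1 h2 hM v (-g1 v / M))
  have e : g v + g1 v * (-g1 v / M) + M * (-g1 v / M) ^ 2 / 2 = (2 * M * g v - g1 v ^ 2) / (2 * M) := by
    field_simp; ring
  rw [e] at h
  by_contra hcon
  push Not at hcon
  have := div_neg_of_neg_of_pos (by linarith : 2 * M * g v - g1 v ^ 2 < 0) (by positivity : 0 < 2 * M)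
  linarith

lemma lb_third {g g1 g2 g3 : ℝ → ℝ} (h1 : ∀ x, HasDerivAt g (g1 x) x)
    (h2 : ∀ x, HasDerivAt g1 (g2 x) x) (h3 : ∀ x, HasDerivAt g2 (g3 x) x)
    {M : ℝ} (hM : ∀ x, |g3 x| ≤ M) (hg : ∀ x, 0 ≤ g x) (v h : ℝ) (hh : 0 ≤ h) :
    0 ≤ 2 * g v + g2 v * h ^ 2 + M * h ^ 3 / 3 := by
  have key : ∀ t, 0 ≤ t → g1 (v + t) - g1 (v - t) - 2 * g2 v * t - M * t ^ 2 ≤ 0 := by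
    intro t ht
    refine lb_nonpos_of_deriv (fun t => g1 (v + t) - g1 (v - t) - 2 * g2 v * t - M * t ^ 2)
      (fun t => g2 (v + t) + g2 (v - t) - 2 * g2 v - 2 * M * t) ?_ (by simp) ?_ t ht
    · intro x
      have := (((lb_shift h2 v x).sub (lb_shift_neg h2 v x)).sub
        ((hasDerivAt_id x).const_mul (2 * g2 v))).sub (((hasDerivAt_id x).pow 2).const_mul M)
      refine this.congr_deriv ?_
      simp; ring
    · intro x hx
      have a := lb_lip h3 hM v (v - x)
      rw [show v - x - v = -x by ring, abs_neg, abs_of_nonneg hx] at a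
      have b := lb_lip h3 hM v (v + x)
      rw [add_sub_cancel_left, abs_of_nonneg hx] at b
      linarith [le_abs_self (g2 (v + x) - g2 v), le_abs_self (g2 (v - x) - g2 v)]
  have := lb_nonpos_of_deriv
    (fun t => g (v + t) + g (v - t) - 2 * g v - g2 v * t ^ 2 - M * t ^ 3 / 3)
    (fun t => g1 (v + t) - g1 (v - t) - 2 * g2 v * t - M * t ^ 2) ?_ (by simp; ring) key h hh
  · linarith [hg (v + h), hg (v - h)]
  · intro x
    have := ((((lb_shift h1 v x).add (lb_shift_neg h1 v x)).sub_const (2 * g v)).sub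
      (((hasDerivAt_id x).pow 2).const_mul (g2 v))).sub
      ((((hasDerivAt_id x).pow 3).const_mul M).div_const 3)
    refine this.congr_deriv ?_
    simp; ring

lemma lb_integrable (Q Q' : ℝ → ℝ) (hd : ∀ x, HasDerivAt Q (Q' x) x) (hc : Continuous Q')
    (hn : ∀ x, 0 ≤ Q' x) (B : ℝ) (hB : ∀ x, |Q x| ≤ B) : Integrable Q' := by
  refine integrable_of_intervalIntegral_norm_bounded (ι := ℕ) (l := Filter.atTop)
    (a := fun n => -(n : ℝ)) (b := fun n => (n : ℝ)) (2 * B)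
    (fun i => (hc.integrableOn_Icc).mono_set Set.Ioc_subset_Icc_self)
    (Filter.tendsto_neg_atTop_atBot.comp tendsto_natCast_atTop_atTop) tendsto_natCast_atTop_atTop
    (Filter.Eventually.of_forall fun n => ?_)
  have : ∀ x, ‖Q' x‖ = Q' x := fun x => by rw [Real.norm_eq_abs, abs_of_nonneg (hn x)]
  simp only [this]
  rw [intervalIntegral.integral_eq_sub_of_hasDerivAt (fun x _ => hd x) (hc.intervalIntegrable _ _)]
  linarith [le_abs_self (Q n), neg_abs_le (Q (-n)), hB n, hB (-n)]

lemma lb_schwartz (g : SchwartzMap ℝ ℝ) (k : ℕ) : ∃ C, 0 ≤ C ∧ ∀ v, (1 + v ^ 2) ^ k * |g v| ≤ C := by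
  refine ⟨2 ^ (2 * k) * (Finset.Iic (2 * k, 0)).sup
    (fun m : ℕ × ℕ => SchwartzMap.seminorm ℝ m.1 m.2) g, by positivity, fun v => ?_⟩
  · have := SchwartzMap.one_add_le_sup_seminorm_apply (𝕜 := ℝ) (m := (2 * k, 0)) (k := 2 * k)
      (n := 0) le_rfl le_rfl g v
    refine le_trans ?_ this
    rw [norm_iteratedFDeriv_zero, pow_mul, Real.norm_eq_abs, Real.norm_eq_abs]
    gcongr
    nlinarith [abs_nonneg v, sq_abs v]

lemma lb_weighted {f f1 f2 : ℝ → ℝ} {C : ℝ} (hC : 1 ≤ C) (h1 : ∀ x, HasDerivAt f (f1 x) x)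
    (h2 : ∀ x, HasDerivAt f1 (f2 x) x) (hf : ∀ x, 0 < f x)
    (b0 : ∀ v, (1 + v ^ 2) * |f v| ≤ C) (b1 : ∀ v, (1 + v ^ 2) * |f1 v| ≤ C)
    (b2 : ∀ v, (1 + v ^ 2) * |f2 v| ≤ C) (v : ℝ) :
    f1 v ^ 2 / f v ≤ 36 * C / (1 + v ^ 2) := by
  have hp : ∀ x : ℝ, 0 < 1 + x ^ 2 := fun x => by positivity
  have hle : ∀ {g : ℝ → ℝ}, (∀ v, (1 + v ^ 2) * |g v| ≤ C) → ∀ x, |g x| ≤ C := by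
    intro g hg x
    refine le_trans ?_ (hg x)
    nlinarith [abs_nonneg (g x), sq_nonneg x]
  have hpd : ∀ x : ℝ, HasDerivAt (fun x : ℝ => 1 + x ^ 2) (2 * x) x := by
    intro x
    simpa using ((hasDerivAt_id x).pow 2).const_add 1
  have key := lb_sq_bound (g := fun x => (1 + x ^ 2) * f x)
    (g1 := fun x => 2 * x * f x + (1 + x ^ 2) * f1 x)
    (g2 := fun x => 2 * f x + 4 * x * f1 x + (1 + x ^ 2) * f2 x) (M := 7 * C)
    (fun x => (hpd x).mul (h1 x)) (fun x => ?_) (by linarith) (fun x => ?_)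
    (fun x => (mul_pos (hp x) (hf x)).le) v
  · have hfv := hf v
    have a0 := hle b0 v
    rw [abs_of_pos hfv] at a0
    have hpv := hp v
    rw [div_le_div_iff₀ hfv hpv]
    set p := 1 + v ^ 2 with hpdef
    have e : (p * f1 v) ^ 2 ≤ 2 * (2 * v * f v + p * f1 v) ^ 2 + 8 * v ^ 2 * f v ^ 2 := by
      nlinarith [sq_nonneg (2 * v * f v + p * f1 v + 2 * v * f v)]
    have e2 : 8 * v ^ 2 * f v ^ 2 ≤ 8 * p * (C * f v) := by
      have : v ^ 2 ≤ p := by linarith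
      have : f v ^ 2 ≤ C * f v := by nlinarith
      calc 8 * v ^ 2 * f v ^ 2 ≤ 8 * p * f v ^ 2 := by gcongr
        _ ≤ _ := by gcongr
    have e3 : p * (f1 v ^ 2 * p) ≤ p * (36 * C * f v) := by nlinarith
    exact le_of_mul_le_mul_left e3 hpv
  · have := (((hasDerivAt_id x).const_mul 2).mul (h1 x)).add ((hpd x).mul (h2 x))
    refine this.congr_deriv ?_
    simp; ring
  · have a0 := hle b0 x
    have a1 := b1 x
    have a2 := b2 x
    have hx : |x| ≤ 1 + x ^ 2 := by nlinarith [sq_abs x, sq_nonneg (|x| - 1), abs_nonneg x]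
    have c1 : |x| * |f1 x| ≤ C := le_trans (by gcongr) a1
    calc |2 * f x + 4 * x * f1 x + (1 + x ^ 2) * f2 x|
        ≤ |2 * f x + 4 * x * f1 x| + |(1 + x ^ 2) * f2 x| := abs_add_le _ _
      _ ≤ |2 * f x| + |4 * x * f1 x| + |(1 + x ^ 2) * f2 x| := by gcongr; exact abs_add_le _ _
      _ = 2 * |f x| + 4 * (|x| * |f1 x|) + (1 + x ^ 2) * |f2 x| := by
        simp only [abs_mul, abs_of_pos (hp x)]; norm_num; ring
      _ ≤ 7 * C := by linarith

lemma lb_bounds {f f1 f2 f3 : ℝ → ℝ} {C : ℝ} (hC : 1 ≤ C) (h1 : ∀ x, HasDerivAt f (f1 x) x)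
    (h2 : ∀ x, HasDerivAt f1 (f2 x) x) (h3 : ∀ x, HasDerivAt f2 (f3 x) x) (hf : ∀ x, 0 < f x)
    (b0 : ∀ v, (1 + v ^ 2) ^ 24 * |f v| ≤ C)
    (bf : ∀ v, f1 v ^ 2 / f v ≤ 36 * C / (1 + v ^ 2))
    (b2 : ∀ v, |f2 v| ≤ C) (b3 : ∀ v, |f3 v| ≤ C) :
    ∃ K, 0 ≤ K ∧ ∀ v, (1 + v ^ 2) ^ 2 * |f v * Real.log (f v)| ≤ K ∧
      (1 + v ^ 2) ^ 2 * |f1 v * Real.log (f v)| ≤ K ∧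
      (1 + v ^ 2) ^ 2 * (f2 v * Real.log (f v)) ≤ K := by
  have hC0 : 0 < C := by linarith
  refine ⟨144 * C ^ 14, by positivity, fun v => ?_⟩
  have hfv := hf v
  set p := 1 + v ^ 2 with hp
  have hp1 : 1 ≤ p := by nlinarith [sq_nonneg v]
  have hp0 : 0 < p := by linarith
  obtain ⟨s, hs, hsf⟩ : ∃ s : ℝ, 0 < s ∧ f v = s ^ 12 := by
    refine ⟨f v ^ ((1:ℝ) / 12), by positivity, ?_⟩
    rw [← Real.rpow_natCast, ← Real.rpow_mul hfv.le]
    norm_num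
  have hsp : p ^ 2 * s ≤ C := by
    have : (p ^ 2 * s) ^ 12 ≤ C ^ 12 := by
      have := b0 v
      rw [abs_of_pos hfv, hsf] at this
      calc (p ^ 2 * s) ^ 12 = p ^ 24 * s ^ 12 := by ring
        _ ≤ C := this
        _ ≤ C ^ 12 := le_self_pow₀ hC (by norm_num)
    exact le_of_pow_le_pow_left₀ (by norm_num) hC0.le this
  have hsC : s ≤ C := le_trans (le_mul_of_one_le_left hs.le (one_le_pow₀ hp1)) hsp
  have hL : Real.log (f v) = 12 * Real.log s := by rw [hsf, Real.log_pow]; norm_num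
  have hl1 : Real.log s ≤ s := (Real.log_le_sub_one_of_pos hs).trans (by linarith)
  have hl2 : -Real.log s ≤ s⁻¹ := by
    rw [← Real.log_inv]
    exact (Real.log_le_sub_one_of_pos (inv_pos.2 hs)).trans (by linarith)
  have hsL : s * |Real.log (f v)| ≤ 24 * C ^ 2 := by
    have hss : s * s⁻¹ = 1 := mul_inv_cancel₀ hs.ne'
    have : |Real.log s| ≤ s + s⁻¹ := by
      rw [abs_le]; constructor <;> linarith [inv_pos.2 hs]
    rw [hL, abs_mul]
    norm_num
    have h5 : s * |Real.log s| ≤ s * (s + s⁻¹) := by gcongr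
    nlinarith
  have hpow : ∀ m n : ℕ, m ≤ n → C ^ m ≤ C ^ n := fun m n h => pow_le_pow_right₀ hC h
  have gen : ∀ (c x : ℝ) (k : ℕ), 0 ≤ c → |x| ≤ c * s ^ (k + 2) →
      p ^ 2 * |x * Real.log (f v)| ≤ 24 * c * C ^ (k + 3) := by
    intro c x k hc hx
    rw [abs_mul]
    calc p ^ 2 * (|x| * |Real.log (f v)|)
        ≤ p ^ 2 * (c * s ^ (k + 2) * |Real.log (f v)|) := by gcongr
      _ = c * s ^ k * (p ^ 2 * s) * (s * |Real.log (f v)|) := by ring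
      _ ≤ c * C ^ k * C * (24 * C ^ 2) := by gcongr
      _ = _ := by ring
  refine ⟨?_, ?_, ?_⟩
  · have := gen 1 (f v) 10 (by norm_num) (by rw [abs_of_pos hfv, hsf]; simp)
    refine this.trans ?_
    have := hpow 13 14 (by norm_num)
    have : 0 ≤ C ^ 14 := by positivity
    norm_num; linarith
  · have h6 : |f1 v| ≤ 6 * C * s ^ (4 + 2) := by
      refine abs_le_of_sq_le_sq ?_ (by positivity)
      have := bf v
      rw [div_le_div_iff₀ hfv hp0, hsf] at this
      have hsq : 0 ≤ f1 v ^ 2 := sq_nonneg _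
      have hs12 : 0 ≤ s ^ 12 := by positivity
      calc f1 v ^ 2 ≤ f1 v ^ 2 * p := le_mul_of_one_le_right hsq hp1
        _ ≤ 36 * C * s ^ 12 := this
        _ ≤ 36 * (C * C) * s ^ 12 := by gcongr; nlinarith
        _ = _ := by ring
    refine (gen _ _ 4 (by positivity) h6).trans ?_
    have := hpow 8 14 (by norm_num)
    ring_nf at this ⊢; linarith
  · rcases le_total 0 (Real.log (f v)) with h0 | h0
    · have h7 : Real.log (f v) ≤ 12 * s := by linarith
      calc p ^ 2 * (f2 v * Real.log (f v)) ≤ p ^ 2 * (C * (12 * s)) := by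
            gcongr
            · exact (le_abs_self _).trans (b2 v)
        _ = 12 * C * (p ^ 2 * s) := by ring
        _ ≤ 12 * C * C := by gcongr
        _ ≤ _ := by
          have := hpow 2 14 (by norm_num)
          have : 0 ≤ C ^ 14 := by positivity
          nlinarith
    · have t := lb_third h1 h2 h3 b3 (fun x => (hf x).le) v (s ^ 4) (by positivity)
      rw [hsf] at t
      have t2 : 0 ≤ s ^ 8 * (2 * s ^ 4 + f2 v + C * s ^ 4 / 3) := by
        refine t.trans (le_of_eq ?_); ring
      have t3 := nonneg_of_mul_nonneg_right t2 (by positivity)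
      have hs4 : 0 < s ^ 4 := by positivity
      have t4 : -f2 v ≤ 3 * C * s ^ (2 + 2) := by norm_num; nlinarith
      have t5 : |max (-f2 v) 0| ≤ 3 * C * s ^ (2 + 2) := by
        rw [abs_of_nonneg (le_max_right _ _)]
        exact max_le t4 (by positivity)
      have t6 := gen _ _ 2 (by positivity) t5
      have t7 : f2 v * Real.log (f v) ≤ |max (-f2 v) 0 * Real.log (f v)| := by
        rw [abs_mul, abs_of_nonpos h0, abs_of_nonneg (le_max_right _ _)]
        nlinarith [le_max_left (-f2 v) 0]
      calc _ ≤ _ := mul_le_mul_of_nonneg_left t7 (by positivity)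
        _ ≤ _ := t6
        _ ≤ _ := by
          have := hpow 6 14 (by norm_num)
          have : 0 ≤ C ^ 14 := by positivity
          ring_nf at *; linarith

lemma lb_int_of_bound {h : ℝ → ℝ} (hc : Continuous h) (K : ℝ)
    (hK : ∀ v, (1 + v ^ 2) * |h v| ≤ K) : Integrable h := by
  refine (integrable_inv_one_add_sq.const_mul K).mono' hc.aestronglyMeasurable
    (Filter.Eventually.of_forall fun v => ?_)
  rw [Real.norm_eq_abs, ← div_eq_mul_inv, le_div_iff₀ (by positivity), mul_comm]
  exact hK v

lemma lb_tendsto {h : ℝ → ℝ} (K : ℝ) (hK : ∀ v, (1 + v ^ 2) * |h v| ≤ K) :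
    Filter.Tendsto h Filter.atBot (nhds 0) ∧ Filter.Tendsto h Filter.atTop (nhds 0) := by
  have hb : ∀ v, ‖h v‖ ≤ K * (1 + v ^ 2)⁻¹ := fun v => by
    rw [Real.norm_eq_abs, ← div_eq_mul_inv, le_div_iff₀ (by positivity), mul_comm]
    exact hK v
  have aux : ∀ l : Filter ℝ, Filter.Tendsto (fun v : ℝ => v ^ 2) l Filter.atTop →
      Filter.Tendsto h l (nhds 0) := by
    intro l hl
    refine squeeze_zero_norm hb ?_
    have := (Filter.tendsto_atTop_add_const_left l 1 hl).inv_tendsto_atTop.const_mul K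
    simpa using this
  refine ⟨aux _ ?_, aux _ (Filter.tendsto_pow_atTop (by norm_num))⟩
  have := (Filter.tendsto_pow_atTop (α := ℝ) (n := 2) (by norm_num)).comp
    Filter.tendsto_neg_atBot_atTop
  simpa [Function.comp_def] using this

lemma lb_lin (u v : ℝ) : |v - u| ≤ (1 + |u|) * (1 + v ^ 2) := by
  have h1 : |v - u| ≤ |v| + |u| := abs_sub v u
  have h2 : |v| ≤ 1 + v ^ 2 := by nlinarith [sq_abs v, sq_nonneg (|v| - 1), abs_nonneg v]
  nlinarith [mul_nonneg (abs_nonneg u) (sq_nonneg v)]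

lemma lb_lin_mul (u v x K : ℝ) (h : (1 + v ^ 2) ^ 2 * |x| ≤ K) :
    (1 + v ^ 2) * |(v - u) * x| ≤ (1 + |u|) * K := by
  rw [abs_mul]
  calc (1 + v ^ 2) * (|v - u| * |x|)
      ≤ (1 + v ^ 2) * (((1 + |u|) * (1 + v ^ 2)) * |x|) := by gcongr; exact lb_lin u v
    _ = (1 + |u|) * ((1 + v ^ 2) ^ 2 * |x|) := by ring
    _ ≤ _ := by gcongr

theorem lenardBernstein_entropy_dissipation (ν : ℝ) (hν : 0 < ν)
    (f : SchwartzMap ℝ ℝ) (hf : ∀ v, 0 < f v)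
    (nf uf θf : ℝ)
    (hn : nf = ∫ v : ℝ, f v) (hnpos : 0 < nf)
    (hu : uf = (1 / nf) * ∫ v : ℝ, v * f v)
    (hθ : θf = (1 / nf) * ∫ v : ℝ, (v - uf) ^ 2 * f v) (hθpos : 0 < θf) :
    (∫ v : ℝ, ν * deriv (fun w => (w - uf) * f w + θf * deriv f w) v * Real.log (f v)) =
      -ν * ∫ v : ℝ,
        ((v - uf) * Real.sqrt (f v) + 2 * θf * deriv (fun w => Real.sqrt (f w)) v) ^ 2 / θf ∧
    (∫ v : ℝ, ν * deriv (fun w => (w - uf) * f w + θf * deriv f w) v * Real.log (f v)) ≤ 0 := by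
  obtain ⟨f1, hf1⟩ : ∃ f1 : SchwartzMap ℝ ℝ, ∀ x, HasDerivAt f (f1 x) x :=
    ⟨SchwartzMap.derivCLM ℝ ℝ f, fun x => f.hasDerivAt x⟩
  obtain ⟨f2, hf2⟩ : ∃ f2 : SchwartzMap ℝ ℝ, ∀ x, HasDerivAt f1 (f2 x) x :=
    ⟨SchwartzMap.derivCLM ℝ ℝ f1, fun x => f1.hasDerivAt x⟩
  obtain ⟨f3, hf3⟩ : ∃ f3 : SchwartzMap ℝ ℝ, ∀ x, HasDerivAt f2 (f3 x) x :=
    ⟨SchwartzMap.derivCLM ℝ ℝ f2, fun x => f2.hasDerivAt x⟩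
  obtain ⟨C0, hC0, d0⟩ := lb_schwartz f 24
  obtain ⟨C1, hC1, d1⟩ := lb_schwartz f1 24
  obtain ⟨C2, hC2, d2⟩ := lb_schwartz f2 24
  obtain ⟨C3, hC3, d3⟩ := lb_schwartz f3 24
  obtain ⟨C, hC, c0, c1, c2, c3⟩ : ∃ C : ℝ, 1 ≤ C ∧ C0 ≤ C ∧ C1 ≤ C ∧ C2 ≤ C ∧ C3 ≤ C :=
    ⟨1 + C0 + C1 + C2 + C3, by linarith, by linarith, by linarith, by linarith, by linarith⟩
  have low : ∀ {g : ℝ → ℝ} {D : ℝ}, (∀ v, (1 + v ^ 2) ^ 24 * |g v| ≤ D) → D ≤ C →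
      ∀ (k : ℕ), k ≤ 24 → ∀ v, (1 + v ^ 2) ^ k * |g v| ≤ C := by
    intro g D hg hD k hk v
    refine le_trans ?_ ((hg v).trans hD)
    gcongr
    nlinarith [sq_nonneg v]
  have bf := lb_weighted hC hf1 hf2 hf
    (fun v => by simpa using low d0 c0 1 (by norm_num) v)
    (fun v => by simpa using low d1 c1 1 (by norm_num) v)
    (fun v => by simpa using low d2 c2 1 (by norm_num) v)
  obtain ⟨K, hK, bK⟩ := lb_bounds hC hf1 hf2 hf3 hf
    (low d0 c0 24 le_rfl) bf
    (fun v => by simpa using low d2 c2 0 (by norm_num) v)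
    (fun v => by simpa using low d3 c3 0 (by norm_num) v)
  have cf : Continuous f := f.continuous
  have cf1 : Continuous f1 := f1.continuous
  have cf2 : Continuous f2 := f2.continuous
  have cL : Continuous (fun v => Real.log (f v)) := cf.log (fun v => (hf v).ne')
  have hderivf : deriv f = f1 := funext fun x => (hf1 x).deriv
  have hG : ∀ v, HasDerivAt (fun w => (w - uf) * f w + θf * f1 w)
      (f v + (v - uf) * f1 v + θf * f2 v) v := by
    intro v
    have := (((hasDerivAt_id v).sub_const uf).mul (hf1 v)).add ((hf2 v).const_mul θf)
    refine this.congr_deriv ?_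
    simp
  have hlog : ∀ v, HasDerivAt (fun w => Real.log (f w)) (f1 v / f v) v :=
    fun v => (hf1 v).log (hf v).ne'
  have hsqrt : ∀ v, deriv (fun w => Real.sqrt (f w)) v = f1 v / (2 * Real.sqrt (f v)) :=
    fun v => ((hf1 v).sqrt (hf v).ne').deriv
  have i1 : Integrable (fun v => (v - uf) * f1 v) :=
    lb_int_of_bound (by fun_prop) _ (fun v => lb_lin_mul uf v _ C (low d1 c1 2 (by norm_num) v))
  have i0 : Integrable (fun v => f v) := f.integrable
  have iF : Integrable (fun v => f1 v ^ 2 / f v) := by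
    refine lb_int_of_bound ((cf1.pow 2).div cf (fun v => (hf v).ne')) (36 * C) (fun v => ?_)
    rw [abs_of_nonneg (div_nonneg (sq_nonneg _) (hf v).le), mul_comm, ← le_div_iff₀ (by positivity)]
    exact bf v
  have i2 : Integrable (fun v => (v - uf) ^ 2 * f v) := by
    refine lb_int_of_bound (by fun_prop) ((1 + |uf|) * ((1 + |uf|) * C)) (fun v => ?_)
    have h := low d0 c0 3 (by norm_num) v
    have h' : (1 + v ^ 2) ^ 2 * |(v - uf) * f v| ≤ (1 + |uf|) * C := by
      have := lb_lin_mul uf v ((1 + v ^ 2) * f v) C (by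
        rw [abs_mul, abs_of_nonneg (by positivity : 0 ≤ 1 + v ^ 2)]
        refine le_trans (le_of_eq ?_) h
        ring)
      refine le_trans (le_of_eq ?_) this
      rw [show (v - uf) * ((1 + v ^ 2) * f v) = (1 + v ^ 2) * ((v - uf) * f v) by ring,
        abs_mul (1 + v ^ 2), abs_of_nonneg (by positivity : 0 ≤ 1 + v ^ 2)]
      ring
    have := lb_lin_mul uf v _ _ h'
    refine le_trans (le_of_eq ?_) this
    congr 2; ring
  set I : ℝ → ℝ := fun v => (f v + (v - uf) * f1 v + θf * f2 v) * Real.log (f v) with hI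
  set P : ℝ → ℝ := fun v => (v - uf) * f1 v + θf * (f1 v ^ 2 / f v) with hP
  have iP : Integrable P := i1.add (iF.const_mul θf)
  set F : ℝ → ℝ := fun v => ((v - uf) * f v + θf * f1 v) * Real.log (f v) with hF
  have dF : ∀ v, HasDerivAt F (I v + P v) v := by
    intro v
    refine ((hG v).mul (hlog v)).congr_deriv ?_
    have := (hf v).ne'
    simp only [hI, hP]
    field_simp
  have cP : Continuous P := by
    have := (cf1.pow 2).div cf (fun v => (hf v).ne')
    simp only [hP]
    exact ((continuous_id.sub continuous_const).mul cf1).add (continuous_const.mul this)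
  have cI : Continuous I := by
    simp only [hI]
    fun_prop
  have p1 : ∀ v : ℝ, 1 ≤ 1 + v ^ 2 := fun v => by nlinarith [sq_nonneg v]
  have drop : ∀ (v x D : ℝ), (1 + v ^ 2) ^ 2 * |x| ≤ D → (1 + v ^ 2) * |x| ≤ D := by
    intro v x D h
    refine le_trans ?_ h
    gcongr
    exact le_self_pow₀ (p1 v) (by norm_num)
  have bF : ∀ v, (1 + v ^ 2) * |F v| ≤ (1 + |uf|) * K + θf * K := by
    intro v
    have a := lb_lin_mul uf v _ K (bK v).1
    have b := drop v _ _ (bK v).2.1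
    have e : F v = (v - uf) * (f v * Real.log (f v)) + θf * (f1 v * Real.log (f v)) := by
      simp only [hF]; ring
    rw [e]
    calc _ ≤ (1 + v ^ 2) * (|(v - uf) * (f v * Real.log (f v))| +
          |θf * (f1 v * Real.log (f v))|) := by gcongr; exact abs_add_le _ _
      _ = (1 + v ^ 2) * |(v - uf) * (f v * Real.log (f v))| +
          θf * ((1 + v ^ 2) * |f1 v * Real.log (f v)|) := by
          rw [abs_mul θf, abs_of_pos hθpos]; ring
      _ ≤ _ := by gcongr
  obtain ⟨B, hB⟩ : ∃ B, ∀ v, (1 + v ^ 2) * (I v + P v) ≤ B := by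
    refine ⟨K + (1 + |uf|) * K + θf * K + (1 + |uf|) * C + θf * (36 * C), fun v => ?_⟩
    have hp : 0 < 1 + v ^ 2 := by positivity
    have a0 := drop v _ _ (bK v).1
    have a1 := lb_lin_mul uf v _ K (bK v).2.1
    have a2 : (1 + v ^ 2) * (f2 v * Real.log (f v)) ≤ K := by
      rcases le_total 0 (f2 v * Real.log (f v)) with h | h
      · refine le_trans ?_ (bK v).2.2
        gcongr
        exact le_self_pow₀ (p1 v) (by norm_num)
      · exact (mul_nonpos_of_nonneg_of_nonpos hp.le h).trans hK
    have a3 := lb_lin_mul uf v _ C (low d1 c1 2 (by norm_num) v)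
    have a4 := bf v
    rw [le_div_iff₀ hp] at a4
    have a5 := mul_le_mul_of_nonneg_left a4 hθpos.le
    have a6 := mul_le_mul_of_nonneg_left a2 hθpos.le
    have l0 := mul_le_mul_of_nonneg_left (le_abs_self (f v * Real.log (f v))) hp.le
    have l1 := mul_le_mul_of_nonneg_left (le_abs_self ((v - uf) * (f1 v * Real.log (f v)))) hp.le
    have l3 := mul_le_mul_of_nonneg_left (le_abs_self ((v - uf) * f1 v)) hp.le
    simp only [hI, hP]
    linarith
  have iQ : Integrable (fun v => B * (1 + v ^ 2)⁻¹ - (I v + P v)) := by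
    refine lb_integrable (fun v => B * Real.arctan v - F v) _ ?_ ?_ ?_
      (|B| * (π / 2) + ((1 + |uf|) * K + θf * K)) ?_
    · intro v
      refine (((Real.hasDerivAt_arctan v).const_mul B).sub (dF v)).congr_deriv ?_
      simp
    · have : Continuous fun v : ℝ => (1 + v ^ 2)⁻¹ :=
        Continuous.inv₀ (by fun_prop) (fun v => by positivity)
      exact (continuous_const.mul this).sub (cI.add cP)
    · intro v
      rw [sub_nonneg, ← div_eq_mul_inv, le_div_iff₀ (by positivity), mul_comm]
      exact hB v
    · intro v
      refine (abs_sub _ _).trans (add_le_add ?_ ?_)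
      · rw [abs_mul]
        gcongr
        exact abs_le.2 ⟨(Real.neg_pi_div_two_lt_arctan v).le, (Real.arctan_lt_pi_div_two v).le⟩
      · exact le_trans (le_mul_of_one_le_left (abs_nonneg _) (p1 v)) (bF v)
  have iIP : Integrable (fun v => I v + P v) := by
    have := (integrable_inv_one_add_sq.const_mul B).sub iQ
    refine this.congr (Filter.Eventually.of_forall fun v => ?_)
    simp
  have iI : Integrable I := by
    have := iIP.sub iP
    refine this.congr (Filter.Eventually.of_forall fun v => ?_)
    simp
  have z1 : ∫ v, (I v + P v) = 0 := by
    have t := lb_tendsto _ bF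
    rw [integral_of_hasDerivAt_of_tendsto dF iIP t.1 t.2, sub_zero]
  rw [integral_add iI iP] at z1
  have i01 : Integrable (fun v => f v + (v - uf) * f1 v) := i0.add i1
  have i1P : Integrable (fun v => (v - uf) * f1 v + P v) := i1.add iP
  have z2 : ∫ v, (f v + (v - uf) * f1 v) = 0 := by
    have t := lb_tendsto (h := fun v => (v - uf) * f v) _
      (fun v => lb_lin_mul uf v _ C (low d0 c0 2 (by norm_num) v))
    rw [integral_of_hasDerivAt_of_tendsto (f := fun v => (v - uf) * f v) (fun v => ?_)
      i01 t.1 t.2, sub_zero]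
    refine (((hasDerivAt_id v).sub_const uf).mul (hf1 v)).congr_deriv ?_
    simp
  rw [integral_add i0 i1, ← hn] at z2
  have z3 : ∫ v, (v - uf) ^ 2 * f v = nf * θf := by
    rw [hθ]; field_simp
  have eL : ∀ v, ν * deriv (fun w => (w - uf) * f w + θf * deriv f w) v * Real.log (f v)
      = ν * I v := by
    intro v
    rw [hderivf, (hG v).deriv]
    simp only [hI]; ring
  have eR : ∀ v, ((v - uf) * Real.sqrt (f v) +
      2 * θf * deriv (fun w => Real.sqrt (f w)) v) ^ 2 / θf
      = (1 / θf) * ((v - uf) ^ 2 * f v) + ((v - uf) * f1 v + P v) := by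
    intro v
    rw [hsqrt]
    simp only [hP]
    have hs : 0 < Real.sqrt (f v) := Real.sqrt_pos.2 (hf v)
    have hss : f v = Real.sqrt (f v) ^ 2 := (Real.sq_sqrt (hf v).le).symm
    generalize Real.sqrt (f v) = s at hs hss
    rw [hss]
    have := hθpos.ne'
    field_simp
    ring
  have main : (∫ v : ℝ, ν * deriv (fun w => (w - uf) * f w + θf * deriv f w) v * Real.log (f v)) =
      -ν * ∫ v : ℝ,
        ((v - uf) * Real.sqrt (f v) + 2 * θf * deriv (fun w => Real.sqrt (f w)) v) ^ 2 / θf := by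
    have j : ∫ v, ((v - uf) * f1 v + P v) = (∫ v, (v - uf) * f1 v) + ∫ v, P v :=
      integral_add i1 iP
    simp only [eL, eR]
    rw [integral_const_mul, integral_add (i2.const_mul _) i1P, integral_const_mul, z3, j]
    have e1 : ∫ v, I v = - ∫ v, P v := by linarith
    have e2 : ∫ v, (v - uf) * f1 v = -nf := by linarith
    rw [e1, e2]
    field_simp
    ring
  refine ⟨main, ?_⟩
  rw [main]
  have : 0 ≤ ∫ v : ℝ,
      ((v - uf) * Real.sqrt (f v) + 2 * θf * deriv (fun w => Real.sqrt (f w)) v) ^ 2 / θf :=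
    integral_nonneg fun v => div_nonneg (sq_nonneg _) hθpos.le
  nlinarith
end

section
/- Let f : ℝ → ℝ be smooth, positive, rapidly decaying with moments n_f > 0, u_f, θ_f > 0. Then ∫_ℝ C(f)·log f dv = 0 if and only if f equals the Maxwellian M(v) = n_f/√(2πθ_f)·exp(−(v−u_f)²/(2θ_f)). -/
open MeasureTheory Real

lemma lb_nonneg_of_deriv {φ φ' : ℝ → ℝ} {T : ℝ} (h : ∀ s, HasDerivAt φ (φ' s) s)
    (h0 : 0 ≤ φ 0) (hp : ∀ s, 0 ≤ s → s ≤ T → 0 ≤ φ' s) (t : ℝ) (ht : 0 ≤ t) (htT : t ≤ T) :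
    0 ≤ φ t := by
  have hm : MonotoneOn φ (Set.Icc 0 T) := by
    refine monotoneOn_of_hasDerivWithinAt_nonneg (convex_Icc 0 T)
      (fun s _ => (h s).continuousAt.continuousWithinAt)
      (fun s _ => (h s).hasDerivWithinAt) ?_
    intro s hs
    have := interior_subset hs
    exact hp s this.1 this.2
  exact h0.trans (hm ⟨le_rfl, ht.trans htT⟩ ⟨ht, htT⟩ ht)

lemma lb_taylor_right {f f1 f2 : ℝ → ℝ} {K T x : ℝ} (h1 : ∀ s, HasDerivAt f (f1 s) s)
    (h2 : ∀ s, HasDerivAt f1 (f2 s) s) (hK : ∀ s, 0 ≤ s → s ≤ T → f2 (x + s) ≤ K)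
    (t : ℝ) (ht : 0 ≤ t) (htT : t ≤ T) :
    f (x + t) ≤ f x + t * f1 x + K * t ^ 2 / 2 := by
  have a1 : ∀ s, 0 ≤ s → s ≤ T → 0 ≤ f1 x + K * s - f1 (x + s) := by
    refine lb_nonneg_of_deriv (φ' := fun s => K - f2 (x + s)) ?_ (by simp)
      (fun s h h' => sub_nonneg.2 (hK s h h'))
    intro s
    have e1 := (h2 (x + s)).comp_const_add x s
    have e2 := (((hasDerivAt_id s).const_mul K).const_add (f1 x)).sub e1
    refine e2.congr_deriv ?_
    simp
  have a2 : ∀ s, 0 ≤ s → s ≤ T → 0 ≤ f x + s * f1 x + K * s ^ 2 / 2 - f (x + s) := by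
    refine lb_nonneg_of_deriv (φ' := fun s => f1 x + K * s - f1 (x + s)) ?_ (by simp) a1
    intro s
    have e1 := (h1 (x + s)).comp_const_add x s
    have e2 := ((((hasDerivAt_id s).mul_const (f1 x)).const_add (f x)).add
      ((((hasDerivAt_id s).pow 2).const_mul K).div_const 2)).sub e1
    refine e2.congr_deriv ?_
    simp
    ring
  linarith [a2 t ht htT]

lemma lb_taylor_left {f f1 f2 : ℝ → ℝ} {K T x : ℝ} (h1 : ∀ s, HasDerivAt f (f1 s) s)
    (h2 : ∀ s, HasDerivAt f1 (f2 s) s) (hK : ∀ s, 0 ≤ s → s ≤ T → f2 (x - s) ≤ K)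
    (t : ℝ) (ht : 0 ≤ t) (htT : t ≤ T) :
    f (x - t) ≤ f x - t * f1 x + K * t ^ 2 / 2 := by
  have e1 : ∀ s, HasDerivAt (fun y => f (-y)) (-f1 (-s)) s := by
    intro s
    have := (h1 (-s)).scomp s (hasDerivAt_neg s)
    simpa [Function.comp_def] using this
  have e2 : ∀ s, HasDerivAt (fun y => -f1 (-y)) (f2 (-s)) s := by
    intro s
    have := ((h2 (-s)).scomp s (hasDerivAt_neg s)).neg
    refine this.congr_deriv ?_
    simp
  have := lb_taylor_right (x := -x) (K := K) (T := T) e1 e2 (by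
    intro s hs hs'
    have := hK s hs hs'
    rwa [show -(-x + s) = x - s by ring]) t ht htT
  rw [show -(-x + t) = x - t by ring, neg_neg] at this
  linarith

/-- First interpolation inequality for nonnegative functions. -/
lemma lb_interp1 {f f1 f2 : ℝ → ℝ} {M : ℝ} (hM : 0 < M) (h1 : ∀ s, HasDerivAt f (f1 s) s)
    (h2 : ∀ s, HasDerivAt f1 (f2 s) s) (hf : ∀ x, 0 ≤ f x) (hK : ∀ s, f2 s ≤ M) (x : ℝ) :
    f1 x ^ 2 ≤ 2 * M * f x := by
  have key : 0 ≤ f x - f1 x ^ 2 / (2 * M) := by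
    rcases le_total 0 (f1 x) with h | h
    · have := lb_taylor_left (x := x) (T := f1 x / M) h1 h2 (fun s _ _ => hK _) (f1 x / M)
        (by positivity) le_rfl
      have h0 := hf (x - f1 x / M)
      have e : f x - f1 x / M * f1 x + M * (f1 x / M) ^ 2 / 2 = f x - f1 x ^ 2 / (2 * M) := by
        field_simp; ring
      linarith
    · have := lb_taylor_right (x := x) (T := -f1 x / M) h1 h2 (fun s _ _ => hK _) (-f1 x / M)
        (div_nonneg (by linarith) hM.le) le_rfl
      have h0 := hf (x + -f1 x / M)
      have e : f x + -f1 x / M * f1 x + M * (-f1 x / M) ^ 2 / 2 = f x - f1 x ^ 2 / (2 * M) := by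
        field_simp; ring
      linarith
  have := (div_le_iff₀ (by positivity : 0 < 2 * M)).1 (sub_nonneg.1 key)
  linarith

/-- Second interpolation inequality for nonnegative functions (negative part of `f''`). -/
lemma lb_interp2 {f f1 f2 f3 : ℝ → ℝ} {M : ℝ} (hM : 0 < M) (h1 : ∀ s, HasDerivAt f (f1 s) s)
    (h2 : ∀ s, HasDerivAt f1 (f2 s) s) (h3 : ∀ s, HasDerivAt f2 (f3 s) s)
    (hf : ∀ x, 0 ≤ f x) (hK : ∀ s, |f3 s| ≤ M) (x : ℝ) (hx : f2 x ≤ 0) :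
    (-f2 x) ^ 3 ≤ 16 * M ^ 2 * f x := by
  set η := -f2 x with hη
  have hη0 : 0 ≤ η := by linarith
  have lip : ∀ y, f2 y ≤ f2 x + M * |y - x| := by
    intro y
    have := Convex.norm_image_sub_le_of_norm_hasDerivWithin_le (f := f2) (f' := f3) (C := M)
      (s := Set.univ) (x := x) (y := y) (fun s _ => (h3 s).hasDerivWithinAt)
      (fun s _ => hK s) convex_univ trivial trivial
    have h := (le_abs_self _).trans this
    rw [Real.norm_eq_abs] at h
    linarith
  set t := η / (2 * M) with ht
  have ht0 : 0 ≤ t := by positivity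
  have hMt : M * t = η / 2 := by rw [ht]; field_simp
  have r := lb_taylor_right (x := x) (T := t) (K := -η / 2) h1 h2 (by
    intro s hs hs'
    have := lip (x + s)
    rw [show x + s - x = s by ring, abs_of_nonneg hs] at this
    nlinarith [mul_le_mul_of_nonneg_left hs' hM.le]) t ht0 le_rfl
  have l := lb_taylor_left (x := x) (T := t) (K := -η / 2) h1 h2 (by
    intro s hs hs'
    have := lip (x - s)
    rw [show x - s - x = -s by ring, abs_neg, abs_of_nonneg hs] at this
    nlinarith [mul_le_mul_of_nonneg_left hs' hM.le]) t ht0 le_rfl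
  have p1 := hf (x + t)
  have p2 := hf (x - t)
  have q : η * t ^ 2 ≤ 4 * f x := by linarith
  have e : η * t ^ 2 = η ^ 3 / (4 * M ^ 2) := by rw [ht]; field_simp; ring
  rw [e, div_le_iff₀ (by positivity)] at q
  linarith

/-- A function with nonnegative derivative and limits at both ends has integrable derivative. -/
lemma lb_integrable_of_nonneg {G D : ℝ → ℝ} {a b : ℝ} (h : ∀ x, HasDerivAt G (D x) x)
    (hD : ∀ x, 0 ≤ D x) (ht : Filter.Tendsto G Filter.atTop (nhds a))
    (hb : Filter.Tendsto G Filter.atBot (nhds b)) : Integrable D := by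
  have i1 : IntegrableOn D (Set.Ioi 0) :=
    integrableOn_Ioi_deriv_of_nonneg' (fun x _ => h x) (fun x _ => hD x) ht
  have i2 : IntegrableOn (fun x => D (-x)) (Set.Ioi 0) := by
    have e1 : ∀ s, HasDerivAt (fun y => -G (-y)) (D (-s)) s := by
      intro s
      have := ((h (-s)).scomp s (hasDerivAt_neg s)).neg
      refine this.congr_deriv ?_
      simp
    exact integrableOn_Ioi_deriv_of_nonneg' (fun x _ => e1 x) (fun x _ => hD _)
      ((hb.comp Filter.tendsto_neg_atTop_atBot).neg)
  have i3 : IntegrableOn D (Set.Iio 0) := by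
    have e : (Neg.neg : ℝ → ℝ) ⁻¹' (Set.Iio 0) = Set.Ioi 0 := by ext; simp
    refine ((Measure.measurePreserving_neg (volume : Measure ℝ)).integrableOn_comp_preimage
      (Homeomorph.neg ℝ).measurableEmbedding).1 ?_
    rw [e]
    exact i2
  rw [← integrableOn_univ, ← Set.Iic_union_Ioi (a := (0 : ℝ))]
  exact ((integrableOn_Iic_iff_integrableOn_Iio (by simp)).2 i3).union i1

lemma lb_decay (f : SchwartzMap ℝ ℝ) (k : ℕ) :
    ∃ C : ℝ, 0 < C ∧ ∀ x, (1 + x ^ 2) ^ k * |f x| ≤ C := by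
  obtain ⟨C, hC⟩ : ∃ C : ℝ, ∀ x, (1 + x ^ 2) ^ k * |f x| ≤ C := by
    have H := fun x => SchwartzMap.one_add_le_sup_seminorm_apply (𝕜 := ℝ) (m := (2 * k, 0))
        (k := 2 * k) (n := 0) le_rfl le_rfl f x
    refine ⟨_, fun x => le_trans ?_ (H x)⟩
    rw [norm_iteratedFDeriv_zero, Real.norm_eq_abs, Real.norm_eq_abs, pow_mul]
    gcongr
    nlinarith [sq_abs x, abs_nonneg x]
  exact ⟨max C 1, by positivity, fun x => (hC x).trans (le_max_left _ _)⟩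

lemma lb_hasDerivAt (f : SchwartzMap ℝ ℝ) (x : ℝ) :
    HasDerivAt f (SchwartzMap.derivCLM ℝ ℝ f x) x := by
  rw [SchwartzMap.derivCLM_apply]
  exact f.differentiableAt.hasDerivAt

lemma lb_integrable_of_le {q : ℝ → ℝ} (hq : Continuous q) {C : ℝ}
    (h : ∀ x, (1 + x ^ 2) * |q x| ≤ C) : Integrable q := by
  refine (integrable_inv_one_add_sq.const_mul C).mono' hq.aestronglyMeasurable
    (Filter.Eventually.of_forall fun x => ?_)
  have h0 : 0 < 1 + x ^ 2 := by positivity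
  rw [Real.norm_eq_abs, ← div_eq_mul_inv, le_div_iff₀ h0]
  linarith [h x]

lemma lb_tendsto_of_le {q : ℝ → ℝ} {C : ℝ} (h : ∀ x, (1 + x ^ 2) * |q x| ≤ C) :
    Filter.Tendsto q (Filter.cocompact ℝ) (nhds 0) := by
  have h1 : Filter.Tendsto (fun x : ℝ => C / ‖x‖) (Filter.cocompact ℝ) (nhds 0) :=
    (tendsto_norm_cocompact_atTop (E := ℝ)).const_div_atTop C
  refine squeeze_zero_norm' ?_ h1
  filter_upwards [(tendsto_norm_cocompact_atTop (E := ℝ)).eventually_gt_atTop 0] with x hx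
  rw [le_div_iff₀ hx, Real.norm_eq_abs, Real.norm_eq_abs]
  have := h x
  nlinarith [sq_abs x, abs_nonneg x, abs_nonneg (q x), sq_nonneg (|x| - 1),
    mul_nonneg (abs_nonneg (q x)) (sq_nonneg (|x| - 1)),
    mul_nonneg (abs_nonneg (q x)) (abs_nonneg x)]

lemma lb_abs_log {r : ℝ} (hr : 0 < r) : |Real.log (r ^ 6)| ≤ 6 * (r + 1 / r) := by
  rw [Real.log_pow]
  have h1 := Real.log_le_sub_one_of_pos hr
  have h2 := Real.log_le_sub_one_of_pos (inv_pos.2 hr)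
  rw [Real.log_inv] at h2
  have h3 : 0 < r⁻¹ := inv_pos.2 hr
  rw [one_div, abs_le]
  push_cast
  constructor <;> linarith

/-- Fisher information of a positive Schwartz function. -/
lemma lb_fisher (f : SchwartzMap ℝ ℝ) (hf : ∀ v, 0 < f v) :
    Integrable (fun x => SchwartzMap.derivCLM ℝ ℝ f x ^ 2 / f x) := by
  set f1 := SchwartzMap.derivCLM ℝ ℝ f with hf1
  set f2 := SchwartzMap.derivCLM ℝ ℝ f1 with hf2
  obtain ⟨C0, hC0, d0⟩ := lb_decay f 1
  obtain ⟨C1, hC1, d1⟩ := lb_decay f1 1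
  obtain ⟨C2, hC2, d2⟩ := lb_decay f2 1
  have D1 : ∀ s, HasDerivAt (fun x => (1 + x ^ 2) * f x) (2 * s * f s + (1 + s ^ 2) * f1 s) s := by
    intro s
    have := (((hasDerivAt_id s).pow 2).const_add 1).mul (lb_hasDerivAt f s)
    refine this.congr_deriv ?_
    simp [hf1]
  have D2 : ∀ s, HasDerivAt (fun s => 2 * s * f s + (1 + s ^ 2) * f1 s)
      (2 * f s + 4 * s * f1 s + (1 + s ^ 2) * f2 s) s := by
    intro s
    have := (((hasDerivAt_id s).const_mul 2).mul (lb_hasDerivAt f s)).add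
      ((((hasDerivAt_id s).pow 2).const_add 1).mul (lb_hasDerivAt f1 s))
    refine this.congr_deriv ?_
    simp [hf1, hf2]
    ring
  have xf1 : ∀ s, |s * f1 s| ≤ C1 := by
    intro s
    refine le_trans ?_ (d1 s)
    rw [abs_mul, pow_one]
    gcongr
    nlinarith [sq_abs s, sq_nonneg (|s| - 1)]
  have B2 : ∀ s, 2 * f s + 4 * s * f1 s + (1 + s ^ 2) * f2 s ≤ 2 * C0 + 4 * C1 + C2 := by
    intro s
    have a0 : f s ≤ C0 := by
      have := d0 s
      rw [abs_of_pos (hf s)] at this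
      nlinarith [hf s, mul_nonneg (sq_nonneg s) (hf s).le]
    have a1 := (le_abs_self _).trans (xf1 s)
    have a2 : (1 + s ^ 2) * f2 s ≤ C2 := by
      refine le_trans ?_ (d2 s)
      rw [pow_one]
      gcongr
      exact le_abs_self _
    linarith
  have key := lb_interp1 (by positivity : 0 < 2 * C0 + 4 * C1 + C2) D1 D2
    (fun x => mul_nonneg (by positivity) (hf x).le) B2
  refine lb_integrable_of_le (C := 2 * (2 * C0 + 4 * C1 + C2) + 4 * C1)
    ((f1.continuous.pow 2).div f.continuous fun x => (hf x).ne') fun x => ?_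
  have hx := hf x
  rw [abs_of_nonneg (by positivity), mul_div_assoc', div_le_iff₀ hx]
  have p : 0 < 1 + x ^ 2 := by positivity
  have k := key x
  have a1 := (abs_le.1 (xf1 x)).1
  have k2 : (1 + x ^ 2) * ((1 + x ^ 2) * f1 x ^ 2) ≤
      (1 + x ^ 2) * ((2 * (2 * C0 + 4 * C1 + C2) + 4 * C1) * f x) := by
    have : 0 ≤ (1 + x ^ 2) * f x * (x * f1 x + C1) := by
      apply mul_nonneg
      · positivity
      · linarith
    nlinarith [sq_nonneg (x * f x)]
  exact le_of_mul_le_mul_left k2 p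

lemma lb_root (f : SchwartzMap ℝ ℝ) (hf : ∀ v, 0 < f v) :
    ∃ r : ℝ → ℝ, Continuous r ∧ (∀ x, 0 < r x) ∧ (∀ x, f x = r x ^ 6) ∧
      ∃ K : ℝ, 0 < K ∧ ∀ x, (1 + x ^ 2) * r x ≤ K := by
  refine ⟨fun x => f x ^ (1 / 6 : ℝ), ?_, fun x => Real.rpow_pos_of_pos (hf x) _, ?_, ?_⟩
  · exact f.continuous.rpow_const fun x => Or.inl (hf x).ne'
  · intro x
    rw [← Real.rpow_natCast, ← Real.rpow_mul (hf x).le]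
    norm_num
  · obtain ⟨C, hC, d⟩ := lb_decay f 6
    refine ⟨1 + C, by positivity, fun x => ?_⟩
    have h6 : (f x ^ (1 / 6 : ℝ)) ^ 6 = f x := by
      rw [← Real.rpow_natCast, ← Real.rpow_mul (hf x).le]
      norm_num
    have hr := Real.rpow_pos_of_pos (hf x) (1 / 6 : ℝ)
    refine le_of_pow_le_pow_left₀ (n := 6) (by norm_num) (by positivity) ?_
    rw [mul_pow, h6]
    have := d x
    rw [abs_of_pos (hf x)] at this
    have h1 : 1 + C ≤ (1 + C) ^ 6 := le_self_pow₀ (by linarith) (by norm_num)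
    linarith

/-- Pointwise estimates needed below. -/
lemma lb_bounds_s9 (f : SchwartzMap ℝ ℝ) (hf : ∀ v, 0 < f v) :
    (∃ C, ∀ x, (1 + x ^ 2) * |f x * Real.log (f x)| ≤ C) ∧
    (∃ C, ∀ x, (1 + x ^ 2) * |x * f x * Real.log (f x)| ≤ C) ∧
    (∃ C, ∀ x, (1 + x ^ 2) * |SchwartzMap.derivCLM ℝ ℝ f x * Real.log (f x)| ≤ C) ∧
    (∃ C, ∀ x, (1 + x ^ 2) * |x * SchwartzMap.derivCLM ℝ ℝ f x * Real.log (f x)| ≤ C) ∧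
    (∃ φ : ℝ → ℝ, Continuous φ ∧ Integrable φ ∧ ∀ x,
      SchwartzMap.derivCLM ℝ ℝ (SchwartzMap.derivCLM ℝ ℝ f) x * Real.log (f x) ≤ φ x) := by
  obtain ⟨r, hrc, hr, hfr, K, hK, hKr⟩ := lb_root f hf
  set f1 := SchwartzMap.derivCLM ℝ ℝ f with hf1
  set f2 := SchwartzMap.derivCLM ℝ ℝ f1 with hf2
  set f3 := SchwartzMap.derivCLM ℝ ℝ f2 with hf3
  obtain ⟨C2, hC2, d2⟩ := lb_decay f2 0
  obtain ⟨C3, hC3, d3⟩ := lb_decay f3 0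
  simp only [pow_zero, one_mul] at d2 d3
  have rK : ∀ x, r x ≤ K := fun x => by nlinarith [hKr x, mul_nonneg (sq_nonneg x) (hr x).le]
  have xrK : ∀ x, |x| * r x ≤ K := fun x => by
    refine le_trans ?_ (hKr x)
    have := hr x
    gcongr
    nlinarith [sq_abs x, sq_nonneg (|x| - 1)]
  obtain ⟨L, hL, rL⟩ : ∃ L, 0 < L ∧ ∀ x, r x * |Real.log (f x)| ≤ L := by
    refine ⟨6 * (K ^ 2 + 1), by positivity, fun x => ?_⟩
    have h0 := hr x
    rw [hfr x]
    calc r x * |Real.log (r x ^ 6)| ≤ r x * (6 * (r x + 1 / r x)) := by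
          gcongr; exact lb_abs_log h0
      _ = 6 * (r x ^ 2 + 1) := by field_simp
      _ ≤ 6 * (K ^ 2 + 1) := by gcongr; exact rK x
  obtain ⟨N, hN, f1N⟩ : ∃ N, 0 < N ∧ ∀ x, |f1 x| ≤ N * r x ^ 3 := by
    refine ⟨2 * C2 + 1, by positivity, fun x => ?_⟩
    have h0 := hr x
    have := lb_interp1 hC2 (lb_hasDerivAt f) (lb_hasDerivAt f1) (fun x => (hf x).le)
      (fun s => (le_abs_self _).trans (d2 s)) x
    refine abs_le_of_sq_le_sq ?_ (by positivity)
    refine this.trans ?_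
    rw [hfr x]
    have h6 : 0 < r x ^ 6 := by positivity
    have : 2 * C2 ≤ (2 * C2 + 1) ^ 2 := by nlinarith
    calc 2 * C2 * r x ^ 6 ≤ (2 * C2 + 1) ^ 2 * r x ^ 6 := by gcongr
      _ = _ := by ring
  have P : ∀ x : ℝ, 0 < 1 + x ^ 2 := fun x => by positivity
  refine ⟨⟨K * K ^ 4 * L, fun x => ?_⟩, ⟨K * K * K ^ 3 * L, fun x => ?_⟩,
    ⟨N * K * K * L, fun x => ?_⟩, ⟨N * K * K * L, fun x => ?_⟩, ?_⟩
  · have h0 := hr x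
    have hp := P x
    rw [abs_mul, abs_of_pos (hf x)]
    calc (1 + x ^ 2) * (f x * |Real.log (f x)|)
        = ((1 + x ^ 2) * r x) * r x ^ 4 * (r x * |Real.log (f x)|) := by
          rw [show f x * |Real.log (f x)| = r x ^ 6 * |Real.log (f x)| by rw [← hfr x]]; ring
      _ ≤ K * K ^ 4 * L := by
          gcongr
          exacts [hKr x, rK x, rL x]
  · have h0 := hr x
    have hp := P x
    rw [abs_mul, abs_mul, abs_of_pos (hf x)]
    calc (1 + x ^ 2) * (|x| * f x * |Real.log (f x)|)
        = ((1 + x ^ 2) * r x) * (|x| * r x) * r x ^ 3 * (r x * |Real.log (f x)|) := by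
          rw [show |x| * f x * |Real.log (f x)| = |x| * r x ^ 6 * |Real.log (f x)| by
            rw [← hfr x]]; ring
      _ ≤ K * K * K ^ 3 * L := by
          gcongr
          exacts [hKr x, xrK x, rK x, rL x]
  · have h0 := hr x
    have hp := P x
    rw [abs_mul]
    calc (1 + x ^ 2) * (|f1 x| * |Real.log (f x)|)
        ≤ (1 + x ^ 2) * (N * r x ^ 3 * |Real.log (f x)|) := by gcongr; exact f1N x
      _ = N * ((1 + x ^ 2) * r x) * r x * (r x * |Real.log (f x)|) := by ring
      _ ≤ N * K * K * L := by
          gcongr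
          exacts [hKr x, rK x, rL x]
  · have h0 := hr x
    have hp := P x
    rw [abs_mul, abs_mul]
    calc (1 + x ^ 2) * (|x| * |f1 x| * |Real.log (f x)|)
        ≤ (1 + x ^ 2) * (|x| * (N * r x ^ 3) * |Real.log (f x)|) := by gcongr; exact f1N x
      _ = N * ((1 + x ^ 2) * r x) * (|x| * r x) * (r x * |Real.log (f x)|) := by ring
      _ ≤ N * K * K * L := by
          gcongr
          exacts [hKr x, xrK x, rL x]
  · have hri : Integrable r := lb_integrable_of_le (C := K) hrc fun x => by
      rw [abs_of_pos (hr x)]; exact hKr x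
    set N' := 16 * C3 ^ 2 + 1 with hN'
    have hN'0 : 1 ≤ N' := by rw [hN']; nlinarith [sq_nonneg C3]
    refine ⟨fun x => C2 * f x + N' * L * r x, by fun_prop,
      (f.integrable.const_mul C2).add (hri.const_mul (N' * L)), fun x => ?_⟩
    have h0 := hr x
    have hx := hf x
    have q1 : 0 ≤ C2 * f x := by positivity
    have q2 : 0 ≤ N' * L * r x := by positivity
    change f2 x * Real.log (f x) ≤ C2 * f x + N' * L * r x
    rcases le_total 0 (Real.log (f x)) with hl | hl
    · have l1 : Real.log (f x) ≤ f x := by linarith [Real.log_le_sub_one_of_pos hx]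
      have := mul_le_mul ((le_abs_self _).trans (d2 x)) l1 hl hC2.le
      linarith
    · rcases le_total 0 (f2 x) with h2 | h2
      · nlinarith [mul_nonneg h2 (neg_nonneg.2 hl)]
      · have i2 := lb_interp2 hC3 (lb_hasDerivAt f) (lb_hasDerivAt f1) (lb_hasDerivAt f2)
          (fun x => (hf x).le) d3 x h2
        have b : -f2 x ≤ N' * r x ^ 2 := by
          refine le_of_pow_le_pow_left₀ (n := 3) (by norm_num) (by positivity) ?_
          refine i2.trans ?_
          rw [hfr x]
          have : N' ≤ N' ^ 3 := le_self_pow₀ hN'0 (by norm_num)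
          calc 16 * C3 ^ 2 * r x ^ 6 ≤ N' ^ 3 * r x ^ 6 := by gcongr; linarith
            _ = _ := by ring
        have : f2 x * Real.log (f x) ≤ N' * L * r x := by
          calc f2 x * Real.log (f x) = (-f2 x) * |Real.log (f x)| := by
                rw [abs_of_nonpos hl]; ring
            _ ≤ N' * r x ^ 2 * |Real.log (f x)| := by gcongr
            _ = N' * r x * (r x * |Real.log (f x)|) := by ring
            _ ≤ N' * r x * L := by gcongr; exact rL x
            _ = _ := by ring
        linarith

lemma lb_log_deriv (f : SchwartzMap ℝ ℝ) (hf : ∀ v, 0 < f v) (x : ℝ) :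
    HasDerivAt (fun x => Real.log (f x)) (SchwartzMap.derivCLM ℝ ℝ f x / f x) x :=
  (lb_hasDerivAt f x).log (hf x).ne'

lemma lb_f2log (f : SchwartzMap ℝ ℝ) (hf : ∀ v, 0 < f v) :
    Integrable (fun x => SchwartzMap.derivCLM ℝ ℝ (SchwartzMap.derivCLM ℝ ℝ f) x
      * Real.log (f x)) := by
  obtain ⟨-, -, ⟨C, hC⟩, -, ⟨φ, hφc, hφ, hle⟩⟩ := lb_bounds_s9 f hf
  have hF := lb_fisher f hf
  set f1 := SchwartzMap.derivCLM ℝ ℝ f with hf1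
  set f2 := SchwartzMap.derivCLM ℝ ℝ f1 with hf2
  have hT := lb_tendsto_of_le hC
  have hsum := hφ.add hF
  have hc : Continuous (fun x => φ x + f1 x ^ 2 / f x) :=
    hφc.add ((f1.continuous.pow 2).div f.continuous fun x => (hf x).ne')
  have hi : Integrable (fun x => φ x + f1 x ^ 2 / f x) := hsum
  have hD : Integrable (fun x => φ x - f2 x * Real.log (f x)) := by
    refine lb_integrable_of_nonneg
      (G := fun x => (∫ t in (0 : ℝ)..x, (φ t + f1 t ^ 2 / f t)) - f1 x * Real.log (f x))
      ?_ (fun x => sub_nonneg.2 (hle x))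
      ((intervalIntegral_tendsto_integral_Ioi 0 hi.integrableOn Filter.tendsto_id).sub
        (hT.mono_left atTop_le_cocompact)) (b := -(∫ t in Set.Iic 0, (φ t + f1 t ^ 2 / f t)) - 0) ?_
    · intro x
      have e1 := (hc.integral_hasStrictDerivAt 0 x).hasDerivAt
      have e2 := (lb_hasDerivAt f1 x).mul (lb_log_deriv f hf x)
      refine (e1.sub e2).congr_deriv ?_
      simp only [← hf1, ← hf2]
      ring
    · refine Filter.Tendsto.sub ?_ (hT.mono_left atBot_le_cocompact)
      have := (intervalIntegral_tendsto_integral_Iic 0 hi.integrableOn Filter.tendsto_id).neg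
      refine this.congr fun x => ?_
      rw [intervalIntegral.integral_symm]
      simp
  have := hφ.sub hD
  refine this.congr (Filter.Eventually.of_forall fun x => ?_)
  simp

lemma lb_int_pow (f : SchwartzMap ℝ ℝ) (k : ℕ) : Integrable (fun x : ℝ => x ^ k * f x) := by
  refine (f.integrable_pow_mul volume k).mono' (by fun_prop)
    (Filter.Eventually.of_forall fun x => ?_)
  rw [norm_mul, norm_pow]

lemma lb_parts (f : SchwartzMap ℝ ℝ) (u : ℝ) :
    Integrable (fun x : ℝ => (x - u) * SchwartzMap.derivCLM ℝ ℝ f x) ∧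
    ∫ x : ℝ, (x - u) * SchwartzMap.derivCLM ℝ ℝ f x = - ∫ x : ℝ, f x := by
  have hi : Integrable (fun x : ℝ => (x - u) * SchwartzMap.derivCLM ℝ ℝ f x) := by
    refine ((lb_int_pow (SchwartzMap.derivCLM ℝ ℝ f) 1).sub
      ((SchwartzMap.derivCLM ℝ ℝ f).integrable.const_mul u)).congr
      (Filter.Eventually.of_forall fun x => ?_)
    simp; ring
  refine ⟨hi, ?_⟩
  obtain ⟨C, hC, d⟩ := lb_decay f 2
  have hT : Filter.Tendsto (fun x : ℝ => (x - u) * f x) (Filter.cocompact ℝ) (nhds 0) := by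
    refine lb_tendsto_of_le (C := (1 + |u|) * C) fun x => ?_
    have h1 : |x - u| ≤ (1 + |u|) * (1 + x ^ 2) := by
      have := abs_sub x u
      nlinarith [abs_nonneg u, abs_nonneg x, sq_abs x, sq_nonneg (|x| - 1),
        mul_nonneg (abs_nonneg u) (sq_nonneg x)]
    rw [abs_mul]
    calc (1 + x ^ 2) * (|x - u| * |f x|)
        ≤ (1 + x ^ 2) * ((1 + |u|) * (1 + x ^ 2) * |f x|) := by gcongr
      _ = (1 + |u|) * ((1 + x ^ 2) ^ 2 * |f x|) := by ring
      _ ≤ (1 + |u|) * C := by gcongr; exact d x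
  have := integral_of_hasDerivAt_of_tendsto (f := fun x : ℝ => (x - u) * f x)
    (f' := fun x => f x + (x - u) * SchwartzMap.derivCLM ℝ ℝ f x) (fun x => by
      have := ((hasDerivAt_id x).sub_const u).mul (lb_hasDerivAt f x)
      refine this.congr_deriv ?_
      simp) (f.integrable.add hi) (hT.mono_left atBot_le_cocompact)
      (hT.mono_left atTop_le_cocompact)
  rw [integral_add f.integrable hi] at this
  linarith

/-- The entropy dissipation identity. -/
lemma lb_dissipation (f : SchwartzMap ℝ ℝ) (hf : ∀ v, 0 < f v) (u θ : ℝ)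
    (hm : ∫ v : ℝ, (v - u) ^ 2 * f v = θ * ∫ v : ℝ, f v) :
    Integrable (fun x => ((x - u) * f x + θ * SchwartzMap.derivCLM ℝ ℝ f x) ^ 2 / f x) ∧
    ∫ x, ((x - u) * f x + θ * SchwartzMap.derivCLM ℝ ℝ f x) ^ 2 / f x =
      - θ * ∫ x, (f x + (x - u) * SchwartzMap.derivCLM ℝ ℝ f x
        + θ * SchwartzMap.derivCLM ℝ ℝ (SchwartzMap.derivCLM ℝ ℝ f) x) * Real.log (f x) := by
  have hF := lb_fisher f hf
  have h2l := lb_f2log f hf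
  obtain ⟨⟨Ca, ha⟩, ⟨Cb, hb⟩, ⟨Cc, hc⟩, ⟨Cd, hd⟩, -⟩ := lb_bounds_s9 f hf
  obtain ⟨hp, hpe⟩ := lb_parts f u
  set f1 := SchwartzMap.derivCLM ℝ ℝ f with hf1
  set f2 := SchwartzMap.derivCLM ℝ ℝ f1 with hf2
  have lc : Continuous (fun x => Real.log (f x)) := f.continuous.log fun x => (hf x).ne'
  have ia := lb_integrable_of_le (f.continuous.mul lc) ha
  have ic := lb_integrable_of_le (f1.continuous.mul lc) hc
  have id := lb_integrable_of_le ((continuous_id.mul f1.continuous).mul lc) hd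
  have hA : Integrable (fun x => (f x + (x - u) * f1 x + θ * f2 x) * Real.log (f x)) := by
    refine (((ia.add id).sub (ic.const_mul u)).add (h2l.const_mul θ)).congr
      (Filter.Eventually.of_forall fun x => ?_)
    simp
    ring
  have hE : Integrable (fun x => (x - u) * f1 x + θ * (f1 x ^ 2 / f x)) :=
    hp.add (hF.const_mul θ)
  have hT : Filter.Tendsto (fun x => ((x - u) * f x + θ * f1 x) * Real.log (f x))
      (Filter.cocompact ℝ) (nhds 0) := by
    have := ((lb_tendsto_of_le hb).sub ((lb_tendsto_of_le ha).const_mul u)).add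
      ((lb_tendsto_of_le hc).const_mul θ)
    simp only [mul_zero, sub_zero, add_zero] at this
    refine this.congr fun x => ?_
    ring
  have I0 := integral_of_hasDerivAt_of_tendsto
    (f := fun x => ((x - u) * f x + θ * f1 x) * Real.log (f x))
    (f' := fun x => (f x + (x - u) * f1 x + θ * f2 x) * Real.log (f x)
      + ((x - u) * f1 x + θ * (f1 x ^ 2 / f x))) (fun x => by
      have := ((((hasDerivAt_id x).sub_const u).mul (lb_hasDerivAt f x)).add
        ((lb_hasDerivAt f1 x).const_mul θ)).mul (lb_log_deriv f hf x)
      refine this.congr_deriv ?_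
      have := (hf x).ne'
      simp [← hf1, ← hf2]
      field_simp) (hA.add hE) (hT.mono_left atBot_le_cocompact)
      (hT.mono_left atTop_le_cocompact)
  rw [integral_add hA hE, integral_add hp (hF.const_mul θ), integral_const_mul] at I0
  have hq : Integrable (fun x : ℝ => (x - u) ^ 2 * f x) := by
    refine (((lb_int_pow f 2).sub ((lb_int_pow f 1).const_mul (2 * u))).add
      (f.integrable.const_mul (u ^ 2))).congr (Filter.Eventually.of_forall fun x => ?_)
    simp
    ring
  have e : (fun x => ((x - u) * f x + θ * f1 x) ^ 2 / f x) = fun x =>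
      ((x - u) ^ 2 * f x + 2 * θ * ((x - u) * f1 x)) + θ ^ 2 * (f1 x ^ 2 / f x) := by
    funext x
    have := (hf x).ne'
    field_simp
    ring
  have s1 := hq.add (hp.const_mul (2 * θ))
  have s1' : Integrable (fun x => (x - u) ^ 2 * f x + 2 * θ * ((x - u) * f1 x)) := s1
  rw [e]
  refine ⟨s1'.add (hF.const_mul (θ ^ 2)), ?_⟩
  rw [integral_add s1' (hF.const_mul _), integral_add hq (hp.const_mul _), integral_const_mul,
    integral_const_mul, hm, hpe]
  rw [hpe] at I0
  linear_combination θ * I0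

lemma lb_gauss (u θ : ℝ) : ∫ v : ℝ, Real.exp (-(v - u) ^ 2 / (2 * θ)) = Real.sqrt (2 * π * θ) := by
  have h := integral_gaussian (1 / (2 * θ))
  have t := integral_sub_right_eq_self (μ := (volume : Measure ℝ))
    (fun x : ℝ => Real.exp (-(1 / (2 * θ)) * x ^ 2)) u
  rw [h] at t
  rw [show 2 * π * θ = π / (1 / (2 * θ)) by rw [div_div_eq_mul_div]; ring, ← t]
  congr 1
  funext v
  congr 1
  ring


/-- H-theorem characterization of equilibria for the Lenard–Bernstein operator:
for smooth, positive, rapidly decaying (Schwartz) `f` with moments `n_f > 0`, `u_f`,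
`θ_f > 0`, the entropy dissipation `∫ C(f)·log f dv` vanishes if and only if `f` is the
Maxwellian `M(v) = n_f/√(2πθ_f)·exp(−(v−u_f)²/(2θ_f))`. -/
theorem lenardBernstein_h_theorem (ν : ℝ) (hν : 0 < ν)
    (f : SchwartzMap ℝ ℝ) (hf : ∀ v, 0 < f v)
    (nf uf θf : ℝ)
    (hn : nf = ∫ v : ℝ, f v) (hnpos : 0 < nf)
    (hu : uf = (1 / nf) * ∫ v : ℝ, v * f v)
    (hθ : θf = (1 / nf) * ∫ v : ℝ, (v - uf) ^ 2 * f v) (hθpos : 0 < θf) :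
    (∫ v : ℝ, ν * deriv (fun w => (w - uf) * f w + θf * deriv f w) v * Real.log (f v)) = 0 ↔
    ∀ v : ℝ, f v =
      nf / Real.sqrt (2 * π * θf) * Real.exp (-(v - uf) ^ 2 / (2 * θf)) := by

  have hd1 : ∀ w, deriv f w = SchwartzMap.derivCLM ℝ ℝ f w := fun w =>
    (SchwartzMap.derivCLM_apply ℝ f w).symm
  simp only [hd1]
  have hdg : ∀ v, HasDerivAt (fun w => (w - uf) * f w + θf * SchwartzMap.derivCLM ℝ ℝ f w)
      (f v + (v - uf) * SchwartzMap.derivCLM ℝ ℝ f v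
        + θf * SchwartzMap.derivCLM ℝ ℝ (SchwartzMap.derivCLM ℝ ℝ f) v) v := by
    intro v
    have := (((hasDerivAt_id v).sub_const uf).mul (lb_hasDerivAt f v)).add
        ((lb_hasDerivAt (SchwartzMap.derivCLM ℝ ℝ f) v).const_mul θf)
    refine this.congr_deriv ?_
    simp
  constructor
  · intro h0
    simp only [(hdg _).deriv, mul_assoc] at h0
    rw [integral_const_mul] at h0
    have h1 := (mul_eq_zero.1 h0).resolve_left hν.ne'
    have hm : ∫ v : ℝ, (v - uf) ^ 2 * f v = θf * ∫ v : ℝ, f v := by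
      rw [← hn, hθ]
      field_simp
    obtain ⟨hBi, hB⟩ := lb_dissipation f hf uf θf hm
    rw [h1, mul_zero, integral_eq_zero_iff_of_nonneg (fun x => div_nonneg (sq_nonneg _) (hf x).le)
      hBi] at hB
    have hcont : Continuous
        (fun x => ((x - uf) * f x + θf * SchwartzMap.derivCLM ℝ ℝ f x) ^ 2 / f x) := by
      refine Continuous.div ?_ f.continuous fun x => (hf x).ne'
      have := (SchwartzMap.derivCLM ℝ ℝ f).continuous
      have := f.continuous
      fun_prop
    have hz := (hcont.ae_eq_iff_eq volume continuous_const).1 hB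
    have hg : ∀ x, (x - uf) * f x + θf * SchwartzMap.derivCLM ℝ ℝ f x = 0 := by
      intro x
      have hzx : ((x - uf) * f x + θf * SchwartzMap.derivCLM ℝ ℝ f x) ^ 2 / f x = 0 :=
        congrFun hz x
      rcases div_eq_zero_iff.1 hzx with h | h
      · exact pow_eq_zero_iff (by norm_num) |>.1 h
      · exact absurd h (hf x).ne'
    have hconst : ∀ x, f x * Real.exp ((x - uf) ^ 2 / (2 * θf)) =
        f 0 * Real.exp ((0 - uf) ^ 2 / (2 * θf)) := by
      have hder : ∀ x, HasDerivAt (fun x => f x * Real.exp ((x - uf) ^ 2 / (2 * θf))) 0 x := by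
        intro x
        have e := ((((hasDerivAt_id x).sub_const uf).pow 2).div_const (2 * θf)).exp
        refine ((lb_hasDerivAt f x).mul e).congr_deriv ?_
        have e2 : SchwartzMap.derivCLM ℝ ℝ f x = -(x - uf) * f x / θf := by
          rw [eq_div_iff hθpos.ne']
          linarith [hg x]
        rw [e2]
        simp
        field_simp
        ring
      intro x
      exact is_const_of_deriv_eq_zero (fun x => (hder x).differentiableAt)
        (fun x => (hder x).deriv) x 0
    set c := f 0 * Real.exp ((0 - uf) ^ 2 / (2 * θf)) with hc
    have hfc : ∀ x, f x = c * Real.exp (-(x - uf) ^ 2 / (2 * θf)) := by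
      intro x
      rw [← hconst x, mul_assoc, ← Real.exp_add]
      rw [show (x - uf) ^ 2 / (2 * θf) + -(x - uf) ^ 2 / (2 * θf) = 0 by ring]
      simp
    have hnc : nf = c * Real.sqrt (2 * π * θf) := by
      rw [hn, ← lb_gauss uf θf, ← integral_const_mul]
      exact integral_congr_ae (Filter.Eventually.of_forall hfc)
    have hs : 0 < Real.sqrt (2 * π * θf) := Real.sqrt_pos.2 (by positivity)
    intro v
    rw [hfc v, hnc, mul_div_assoc, div_self hs.ne', mul_one]
  · intro hM
    have hg : (fun w => (w - uf) * f w + θf * SchwartzMap.derivCLM ℝ ℝ f w) = fun _ => 0 := by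
      funext w
      have e := (((((hasDerivAt_id w).sub_const uf).pow 2).neg.div_const (2 * θf)).exp).const_mul
        (nf / Real.sqrt (2 * π * θf))
      have e' : HasDerivAt f _ w := e.congr_of_eventuallyEq (Filter.Eventually.of_forall hM)
      rw [(lb_hasDerivAt f w).unique e', hM w]
      simp
      field_simp
      ring
    rw [hg]
    simp
end
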